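/- arXiv:2209.13908 — 4 statements merged into one kernel-verified Lean document; each statement's English description precedes it below -/
import Mathlib

section
/- Let E be a real normed vector space. Let α, ζ, η : [0,∞) → [0,∞) be continuous monotone increasing functions with α strictly increasing and α(0) = ζ(0) = η(0) = 0. Let I be a nonempty finite index set and let V_i : E → ℝ (i ∈ I) be functions, each continuous at 0 with V_i(0) = 0, such that max_{i∈I} V_i(x) ≥ α(‖x‖) for all x ∈ E. Then for every ε > 0 there exists δ > 0 with the following property: for every function x : [0,∞) → E and every strictly increasing sequence of times t_0 = 0 < t_1 < t_2 < ... with sup_k t_k = ∞ satisfying, for every k ≥ 0, (i) t_{k+1} − t_k ≤ ζ(‖x(t_k)‖), (ii) ‖x(s)‖ ≤ ‖x(t_k)‖ + η(s − t_k) for all s ∈ [t_k, t_{k+1}], and (iii) V_i(x(t_{k+1})) ≤ V_i(x(t_k)) for every i ∈ I, if ‖x(0)‖ < δ then ‖x(t)‖ < ε for all t ≥ 0. (Main improved stability condition, Theorem 2, in abstract form.) -/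
open Filter Topology in
/-- If `ζ ≥ 0` and `η` are right-continuous and vanish at `0`, then `r + η (ζ r)` is below any
given `ε > 0` for some `r > 0`. -/
theorem exists_pos_add_comp_lt {ζ η : ℝ → ℝ}
    (hζ : ContinuousWithinAt ζ (Set.Ici 0) 0) (hη : ContinuousWithinAt η (Set.Ici 0) 0)
    (hζ_nonneg : ∀ t ∈ Set.Ici (0 : ℝ), 0 ≤ ζ t) (hζ0 : ζ 0 = 0) (hη0 : η 0 = 0)
    {ε : ℝ} (hε : 0 < ε) : ∃ r > 0, r + η (ζ r) < ε := by
  have hcomp : ContinuousWithinAt (fun r => r + η (ζ r)) (Set.Ici 0) 0 :=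
    continuousWithinAt_id.add (ContinuousWithinAt.comp (hζ0.symm ▸ hη) hζ hζ_nonneg)
  have hlim : Tendsto (fun r => r + η (ζ r)) (𝓝[>] 0) (𝓝 0) := by
    simpa [hζ0, hη0] using (hcomp.mono Set.Ioi_subset_Ici_self).tendsto
  obtain ⟨r, hr, hr0⟩ := ((hlim.eventually_lt_const hε).and self_mem_nhdsWithin).exists
  exact ⟨r, hr0, hr⟩

/-- Consecutive terms of an unbounded real sequence bracket every `s` above its first term. -/
theorem exists_mem_Icc_succ_of_tendsto_atTop {t : ℕ → ℝ}
    (ht : Filter.Tendsto t Filter.atTop Filter.atTop) {s : ℝ} (hs : t 0 ≤ s) :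
    ∃ k, s ∈ Set.Icc (t k) (t (k + 1)) := by
  by_contra! h
  have hle : ∀ k, t k ≤ s := fun k => by
    induction k with
    | zero => exact hs
    | succ k ih => exact (not_le.mp fun hk => h k ⟨ih, hk⟩).le
  obtain ⟨k, hk⟩ := (ht.eventually_gt_atTop s).exists
  exact (hle k).not_gt hk

/-- Main improved stability condition (Theorem 2) in abstract form:
multiple Lyapunov functions which are non-increasing when sampled at a
sequence of event times (impacts / contact mode transitions), with
impact-boundedness (i) and an inter-event drift bound (ii), imply
Lyapunov stability. -/
theorem improved_stability_condition {E : Type*} [NormedAddCommGroup E] [NormedSpace ℝ E]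
    {I : Type*} [Fintype I] [Nonempty I]
    (α ζ η : ℝ → ℝ)
    (hαc : ContinuousOn α (Set.Ici 0)) (hζc : ContinuousOn ζ (Set.Ici 0))
    (hηc : ContinuousOn η (Set.Ici 0))
    (hα_smono : StrictMonoOn α (Set.Ici 0))
    (hζ_mono : MonotoneOn ζ (Set.Ici 0)) (hη_mono : MonotoneOn η (Set.Ici 0))
    (hα_nonneg : ∀ t ∈ Set.Ici (0 : ℝ), 0 ≤ α t)
    (hζ_nonneg : ∀ t ∈ Set.Ici (0 : ℝ), 0 ≤ ζ t)
    (hη_nonneg : ∀ t ∈ Set.Ici (0 : ℝ), 0 ≤ η t)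
    (hα0 : α 0 = 0) (hζ0 : ζ 0 = 0) (hη0 : η 0 = 0)
    (V : I → E → ℝ)
    (hVcont : ∀ i, ContinuousAt (V i) 0) (hV0 : ∀ i, V i 0 = 0)
    (hVlb : ∀ x : E, α ‖x‖ ≤ Finset.univ.sup' Finset.univ_nonempty (fun i => V i x)) :
    ∀ ε > 0, ∃ δ > 0, ∀ (x : ℝ → E) (t : ℕ → ℝ),
      t 0 = 0 → StrictMono t → Filter.Tendsto t Filter.atTop Filter.atTop →
      (∀ k : ℕ, t (k + 1) - t k ≤ ζ ‖x (t k)‖) →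
      (∀ k : ℕ, ∀ s ∈ Set.Icc (t k) (t (k + 1)), ‖x s‖ ≤ ‖x (t k)‖ + η (s - t k)) →
      (∀ k : ℕ, ∀ i : I, V i (x (t (k + 1))) ≤ V i (x (t k))) →
      ‖x 0‖ < δ → ∀ s ≥ (0 : ℝ), ‖x s‖ < ε := by
  intro ε hε
  obtain ⟨r, hr0, hr⟩ := exists_pos_add_comp_lt (hζc 0 Set.self_mem_Ici)
    (hηc 0 Set.self_mem_Ici) hζ_nonneg hζ0 hη0 hε
  have hαr : 0 < α r := hα0 ▸ hα_smono Set.self_mem_Ici hr0.le hr0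
  have hVsmall : ∀ᶠ y in nhds (0 : E), ∀ i, V i y < α r :=
    Filter.eventually_all.2 fun i => (hVcont i).eventually_lt_const ((hV0 i).symm ▸ hαr)
  obtain ⟨δ, hδ, hball⟩ := Metric.eventually_nhds_iff.1 hVsmall
  refine ⟨δ, hδ, fun x t ht0 htmono httop hgap hdrift hdecr hx0 s hs => ?_⟩
  have hVlt : ∀ k i, V i (x (t k)) < α r := fun k i => by
    induction k with
    | zero => exact hball (by simpa [ht0] using hx0) i
    | succ k ih => exact (hdecr k i).trans_lt ih
  have hnorm : ∀ k, ‖x (t k)‖ < r := fun k =>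
    (hα_smono.lt_iff_lt (norm_nonneg _) hr0.le).1 <|
      (hVlb _).trans_lt ((Finset.sup'_lt_iff _).2 fun i _ => hVlt k i)
  obtain ⟨k, hk⟩ := exists_mem_Icc_succ_of_tendsto_atTop httop (ht0.trans_le hs)
  have hstep : s - t k ≤ ζ r :=
    (sub_le_sub_right hk.2 _).trans <|
      (hgap k).trans (hζ_mono (norm_nonneg _) hr0.le (hnorm k).le)
  calc ‖x s‖ ≤ ‖x (t k)‖ + η (s - t k) := hdrift k s hk
    _ ≤ r + η (ζ r) :=
      add_le_add (hnorm k).le (hη_mono (sub_nonneg.2 hk.1) (hζ_nonneg r hr0.le) hstep)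
    _ < ε := hr
end

section
/- Let α, L₁, L₂ be real numbers with 0 < α < π/2 and L₁·L₂ < 0, and let y, z, θ, u, v, ω, V₂ be real numbers satisfying z + L₁·θ ≥ 0, z + L₂·θ ≥ 0, y ≥ (1/2)·(cos α / sin α)·z, and V₂ ≥ y + u⁴ + v⁴ + ω⁴. Then: V₂ ≥ |y|, V₂ ≥ (1/2)·(cos α / sin α)·|z|, V₂ ≥ (1/2)·(cos α / sin α)·min(|L₁|,|L₂|)·|θ|, V₂ ≥ u⁴, V₂ ≥ v⁴, and V₂ ≥ ω⁴. -/
/-- If `L₁` and `L₂` have opposite signs, the two constraints `z + Lᵢ θ ≥ 0` bound `|θ|` by `z`. -/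
theorem min_abs_mul_abs_le_of_mul_neg {L₁ L₂ z θ : ℝ} (hL : L₁ * L₂ < 0)
    (h1 : 0 ≤ z + L₁ * θ) (h2 : 0 ≤ z + L₂ * θ) : min |L₁| |L₂| * |θ| ≤ z := by
  wlog h : L₁ * θ ≤ 0 generalizing L₁ L₂
  · rw [min_comm]
    refine this (by rwa [mul_comm]) h2 h1 ?_
    by_contra! h'
    nlinarith [mul_pos (not_le.mp h) h', sq_nonneg θ]
  calc min |L₁| |L₂| * |θ| ≤ |L₁| * |θ| := by gcongr; exact min_le_left _ _
    _ = -(L₁ * θ) := by rw [← abs_mul, abs_of_nonpos h]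
    _ ≤ z := by linarith

/-- Verification of condition 3a) for the planar biped on the half-space
`y ≥ (1/2)·cot(α)·z`: lower bounds on the second Lyapunov function `V₂`. -/
theorem V2_bounds (α L₁ L₂ y z θ u v ω V₂ : ℝ)
    (hα0 : 0 < α) (hα1 : α < Real.pi / 2) (hL : L₁ * L₂ < 0)
    (h1 : z + L₁ * θ ≥ 0) (h2 : z + L₂ * θ ≥ 0)
    (hy : y ≥ (1 / 2) * (Real.cos α / Real.sin α) * z)
    (hV : V₂ ≥ y + u ^ 4 + v ^ 4 + ω ^ 4) :
    V₂ ≥ |y| ∧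
    V₂ ≥ (1 / 2) * (Real.cos α / Real.sin α) * |z| ∧
    V₂ ≥ (1 / 2) * (Real.cos α / Real.sin α) * min |L₁| |L₂| * |θ| ∧
    V₂ ≥ u ^ 4 ∧ V₂ ≥ v ^ 4 ∧ V₂ ≥ ω ^ 4 := by
  have hc : 0 < (1 / 2) * (Real.cos α / Real.sin α) := by
    have hcos : 0 < Real.cos α := Real.cos_pos_of_mem_Ioo ⟨by linarith, hα1⟩
    have hsin : 0 < Real.sin α := Real.sin_pos_of_pos_of_lt_pi hα0 (by linarith)
    positivity
  have hθ := min_abs_mul_abs_le_of_mul_neg hL h1 h2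
  have hz : 0 ≤ z := le_trans (by positivity) hθ
  have hcz := mul_nonneg hc.le hz
  have hcθ := mul_le_mul_of_nonneg_left hθ hc.le
  have hu : 0 ≤ u ^ 4 := by positivity
  have hv : 0 ≤ v ^ 4 := by positivity
  have hω : 0 ≤ ω ^ 4 := by positivity
  rw [abs_of_nonneg (hcz.trans hy), abs_of_nonneg hz, mul_assoc _ (min _ _)]
  refine ⟨?_, ?_, ?_, ?_, ?_, ?_⟩ <;> linarith
end

section
/- Let α, L₁, L₂ be real numbers with 0 < α < π/2 and L₁·L₂ < 0. Define V₁ : ℝ⁶ → ℝ by V₁(y, z, θ, u, v, ω) = (1/2)·(u² + v² + ω²) + z·cos α − y·sin α, and let V₂ : ℝ⁶ → ℝ be any function satisfying V₂(y, z, θ, u, v, ω) ≥ y + u⁴ + v⁴ + ω⁴ for all arguments. Then there exists a continuous, strictly increasing function α̂ : [0,∞) → [0,∞) with α̂(0) = 0 such that for every state x = (y, z, θ, u, v, ω) satisfying the admissibility constraints z + L₁·θ ≥ 0 and z + L₂·θ ≥ 0, one has max(V₁(x), V₂(x)) ≥ α̂(‖x‖), where ‖x‖ = max(|y|, |z|,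 |θ|, |u|, |v|, |ω|). -/
theorem sq_div_one_add_strictMonoOn :
    StrictMonoOn (fun t : ℝ => t ^ 2 / (1 + t)) (Set.Ici 0) := by
  intro a ha b hb hab
  have ha : 0 ≤ a := ha
  have hb : 0 ≤ b := hb
  change a ^ 2 / (1 + a) < b ^ 2 / (1 + b)
  rw [div_lt_div_iff₀ (by linarith) (by linarith)]
  have : 0 < (b - a) * (a + b + a * b) := by
    have := mul_nonneg ha hb
    exact mul_pos (by linarith) (by linarith)
  linarith

theorem sq_div_one_add_le_of_le {t B : ℝ} (ht : 0 ≤ t) (h : t ≤ B) :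
    t ^ 2 / (1 + t) ≤ B := by
  rw [div_le_iff₀ (by linarith)]
  nlinarith

theorem sq_div_one_add_le_of_sq_le {t B : ℝ} (ht : 0 ≤ t) (h : t ^ 2 ≤ B) :
    t ^ 2 / (1 + t) ≤ B :=
  (div_le_self (sq_nonneg t) (by linarith)).trans h

/-- Contacts on opposite sides of the center of mass: the linearized non-penetration
constraints bound the rotation by the height. -/
theorem min_abs_mul_abs_le_of_constraints {L₁ L₂ z θ : ℝ} (hL : L₁ * L₂ < 0)
    (h₁ : 0 ≤ z + L₁ * θ) (h₂ : 0 ≤ z + L₂ * θ) :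
    min |L₁| |L₂| * |θ| ≤ z := by
  have hθ := abs_nonneg θ
  have hprod : (L₁ * θ) * (L₂ * θ) ≤ 0 := by nlinarith [sq_nonneg θ]
  rcases le_total (L₁ * θ) 0 with h | h
  · calc min |L₁| |L₂| * |θ| ≤ |L₁| * |θ| := by gcongr; exact min_le_left _ _
      _ = -(L₁ * θ) := by rw [← abs_mul, abs_of_nonpos h]
      _ ≤ z := by linarith
  · have h' : L₂ * θ ≤ 0 := by
      by_contra! hpos
      rcases h.eq_or_lt with h0 | h0
      · rcases mul_eq_zero.mp h0.symm with h0 | h0 <;> simp [h0] at hL hpos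
      · linarith [mul_pos h0 hpos]
    calc min |L₁| |L₂| * |θ| ≤ |L₂| * |θ| := by gcongr; exact min_le_right _ _
      _ = -(L₂ * θ) := by rw [← abs_mul, abs_of_nonpos h']
      _ ≤ z := by linarith

/-- The Appendix's verification of condition 3a) of the main stability theorem
for the planar biped: on the admissible set given by the linearized
non-penetration constraints, the maximum of the mechanical energy `V₁` and any
candidate `V₂` satisfying the polynomial lower bound admits a radial lower
bound by a continuous strictly increasing function vanishing at 0, in the
supremum norm on the state `(y, z, θ, u, v, ω)`. -/
theorem condition_3a_biped (α L₁ L₂ : ℝ)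
    (hα0 : 0 < α) (hα1 : α < Real.pi / 2) (hL : L₁ * L₂ < 0)
    (V₂ : ℝ → ℝ → ℝ → ℝ → ℝ → ℝ → ℝ)
    (hV₂ : ∀ y z θ u v ω : ℝ, V₂ y z θ u v ω ≥ y + u ^ 4 + v ^ 4 + ω ^ 4) :
    ∃ α' : ℝ → ℝ,
      ContinuousOn α' (Set.Ici 0) ∧ StrictMonoOn α' (Set.Ici 0) ∧
      (∀ t ∈ Set.Ici (0 : ℝ), 0 ≤ α' t) ∧ α' 0 = 0 ∧
      ∀ y z θ u v ω : ℝ, z + L₁ * θ ≥ 0 → z + L₂ * θ ≥ 0 →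
        max ((1 / 2) * (u ^ 2 + v ^ 2 + ω ^ 2) + z * Real.cos α - y * Real.sin α)
            (V₂ y z θ u v ω) ≥
          α' (max |y| (max |z| (max |θ| (max |u| (max |v| |ω|))))) := by
  have hs : 0 < Real.sin α := Real.sin_pos_of_pos_of_lt_pi hα0 (by linarith [Real.pi_pos])
  have hc : 0 < Real.cos α := Real.cos_pos_of_mem_Ioo ⟨by linarith [Real.pi_pos], hα1⟩
  have hs1 : Real.sin α ≤ 1 := Real.sin_le_one α
  have hm : 0 < min |L₁| |L₂| :=
    lt_min (abs_pos.mpr (left_ne_zero_of_mul hL.ne)) (abs_pos.mpr (right_ne_zero_of_mul hL.ne))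
  generalize Real.sin α = s at *
  generalize Real.cos α = c at *
  obtain ⟨m, hm_eq⟩ : ∃ m, m = min |L₁| |L₂| := ⟨_, rfl⟩
  rw [← hm_eq] at hm
  obtain ⟨D, hD⟩ : ∃ D, D = 1 / s + 2 / c + 2 / c / m + 4 := ⟨_, rfl⟩
  have hs' : 0 < 1 / s := by positivity
  have hc' : 0 < 2 / c := by positivity
  have hm' : 0 < 2 / c / m := by positivity
  have hD0 : 0 < D := by linarith
  refine ⟨fun t => t ^ 2 / (1 + t) / D, ?_, ?_, ?_, by simp, ?_⟩
  · refine ContinuousOn.div_const (ContinuousOn.div (by fun_prop) (by fun_prop) ?_) D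
    intro t ht
    have ht : 0 ≤ t := ht
    positivity
  · intro a ha b hb hab
    exact div_lt_div_of_pos_right (sq_div_one_add_strictMonoOn ha hb hab) hD0
  · intro t ht
    have ht : 0 ≤ t := ht
    positivity
  · intro y z θ u v ω h₁ h₂
    have hθz := min_abs_mul_abs_le_of_constraints hL h₁ h₂
    rw [← hm_eq] at hθz
    have hz : 0 ≤ z := le_trans (by positivity) hθz
    have hV := hV₂ y z θ u v ω
    generalize V₂ y z θ u v ω = W at *
    have hM1 := le_max_left ((1 / 2) * (u ^ 2 + v ^ 2 + ω ^ 2) + z * c - y * s) W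
    have hM2 := le_max_right ((1 / 2) * (u ^ 2 + v ^ 2 + ω ^ 2) + z * c - y * s) W
    generalize max ((1 / 2) * (u ^ 2 + v ^ 2 + ω ^ 2) + z * c - y * s) W = M at *
    have hu := sq_nonneg u
    have hv := sq_nonneg v
    have hω := sq_nonneg ω
    have h4 : 0 ≤ u ^ 4 + v ^ 4 + ω ^ 4 := by positivity
    have hyM : y ≤ M := by linarith
    have hzc : 0 ≤ z * c := by positivity
    have hsum : (1 / 2) * (u ^ 2 + v ^ 2 + ω ^ 2) + z * c ≤ (1 + s) * M := by
      linarith [mul_le_mul_of_nonneg_left hyM hs.le]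
    have hM : 0 ≤ M := by
      by_contra! hneg
      linarith [mul_neg_of_pos_of_neg (by linarith : 0 < 1 + s) hneg]
    have hsum' : (1 / 2) * (u ^ 2 + v ^ 2 + ω ^ 2) + z * c ≤ 2 * M := by
      linarith [mul_le_mul_of_nonneg_right hs1 hM]
    have hyb : |y| ≤ 1 / s * M := by
      rw [one_div_mul_eq_div, le_div_iff₀ hs]
      rcases abs_cases y with ⟨h, -⟩ | ⟨h, -⟩ <;> rw [h]
      · linarith [mul_le_mul_of_nonneg_left hyM hs.le, mul_le_mul_of_nonneg_right hs1 hM]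
      · linarith
    have hzb : z ≤ 2 / c * M := by
      rw [div_mul_eq_mul_div, le_div_iff₀ hc]
      linarith
    have hθb : |θ| ≤ 2 / c / m * M := by
      rw [div_mul_eq_mul_div, le_div_iff₀ hm]
      linarith
    have hsM : 0 ≤ 1 / s * M := by positivity
    have hcM : 0 ≤ 2 / c * M := by positivity
    have hmM : 0 ≤ 2 / c / m * M := by positivity
    have hDM : D * M = 1 / s * M + 2 / c * M + 2 / c / m * M + 4 * M := by rw [hD]; ring
    have hlin : ∀ t : ℝ, 0 ≤ t → t ≤ D * M → t ^ 2 / (1 + t) / D ≤ M := fun t ht h =>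
      (div_le_iff₀' hD0).mpr (sq_div_one_add_le_of_le ht h)
    have hsq : ∀ w : ℝ, w ^ 2 ≤ D * M → |w| ^ 2 / (1 + |w|) / D ≤ M := fun w h =>
      (div_le_iff₀' hD0).mpr (sq_div_one_add_le_of_sq_le (abs_nonneg w) (by rwa [sq_abs]))
    let p : ℝ → Prop := fun t => t ^ 2 / (1 + t) / D ≤ M
    have hmax : ∀ a b : ℝ, p a → p b → p (max a b) := fun a b ha hb => max_rec' p ha hb
    exact hmax _ _ (hlin _ (abs_nonneg y) (by linarith)) <|
      hmax _ _ (hlin _ (abs_nonneg z) (by rw [abs_of_nonneg hz]; linarith)) <|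
      hmax _ _ (hlin _ (abs_nonneg θ) (by linarith)) <|
      hmax _ _ (hsq u (by linarith)) <| hmax _ _ (hsq v (by linarith)) (hsq ω (by linarith))
end

section
/- Let n be a positive natural number, H an n×n real positive definite symmetric matrix, J_γ, J_σ, J_N, J_T ∈ ℝⁿ vectors, v⁻ ∈ ℝⁿ, and e a real number. Assume the 2×2 real matrix M with entries M₁₁ = J_γᵀ·H⁻¹·J_N, M₁₂ = J_γᵀ·H⁻¹·J_T, M₂₁ = J_σᵀ·H⁻¹·J_N, M₂₂ = J_σᵀ·H⁻¹·J_T is invertible. Then there exist unique real numbers Λ_N, Λ_T and a unique vector v⁺ ∈ ℝⁿ satisfying simultaneously: (i) the impulse–momentum equation H·(v⁺ − v⁻) = Λ_N·J_N + Λ_T·J_T, (ii) the restitution law J_γᵀ·v⁺ = −e·(J_γᵀ·v⁻), and (iii) the sticking condition J_σᵀ·v⁺ = 0. -/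
open Matrix

/-- For invertible `H`, the impulse–momentum equation solved for the post-impact velocity. -/
theorem mulVec_sub_eq_smul_add_smul_iff {n : ℕ} {H : Matrix (Fin n) (Fin n) ℝ}
    (hH : IsUnit H.det) (J K u v : Fin n → ℝ) (x y : ℝ) :
    H *ᵥ (v - u) = x • J + y • K ↔ v = u + (x • (H⁻¹ *ᵥ J) + y • (H⁻¹ *ᵥ K)) := by
  rw [← mulVec_smul, ← mulVec_smul, ← mulVec_add, ← sub_eq_iff_eq_add' (a := v) (b := u)]
  constructor
  · intro h
    rw [← h, mulVec_mulVec, nonsing_inv_mul _ hH, one_mulVec]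
  · intro h
    rw [h, mulVec_mulVec, mul_nonsing_inv _ hH, one_mulVec]

/-- Cramer's rule for two equations in two unknowns. -/
theorem linear_system_two_iff {a b c d r s x y : ℝ} (hD : a * d - b * c ≠ 0) :
    (x * a + y * b = r ∧ x * c + y * d = s) ↔
      x = (r * d - b * s) / (a * d - b * c) ∧ y = (a * s - c * r) / (a * d - b * c) := by
  rw [eq_div_iff hD, eq_div_iff hD]
  constructor
  · rintro ⟨rfl, rfl⟩
    constructor <;> ring
  · rintro ⟨hx, hy⟩
    constructor <;> apply mul_right_cancel₀ hD
    · linear_combination a * hx + b * hy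
    · linear_combination c * hx + d * hy

/-- Sticking single-point impact in the Whittaker–Kane–Levinson rigid impact
model: if the 2×2 matrix of contact-space inverse inertias is invertible, the
impulse–momentum equation, the Newtonian restitution law, and the sticking
condition determine the impulses `Λ_N, Λ_T` and the post-impact velocity `v⁺`
uniquely. -/
theorem sticking_impact_exists_unique (n : ℕ) (hn : 0 < n)
    (H : Matrix (Fin n) (Fin n) ℝ) (hH : H.PosDef)
    (Jγ Jσ JN JT vminus : Fin n → ℝ) (e : ℝ)
    (M : Matrix (Fin 2) (Fin 2) ℝ)
    (hM : M = !![Jγ ⬝ᵥ (H⁻¹ *ᵥ JN), Jγ ⬝ᵥ (H⁻¹ *ᵥ JT);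
                 Jσ ⬝ᵥ (H⁻¹ *ᵥ JN), Jσ ⬝ᵥ (H⁻¹ *ᵥ JT)])
    (hMinv : IsUnit M.det) :
    ∃! p : ℝ × ℝ × (Fin n → ℝ),
      H *ᵥ (p.2.2 - vminus) = p.1 • JN + p.2.1 • JT ∧
      Jγ ⬝ᵥ p.2.2 = -e * (Jγ ⬝ᵥ vminus) ∧
      Jσ ⬝ᵥ p.2.2 = 0 := by
  have hD : Jγ ⬝ᵥ (H⁻¹ *ᵥ JN) * Jσ ⬝ᵥ (H⁻¹ *ᵥ JT) -
      Jγ ⬝ᵥ (H⁻¹ *ᵥ JT) * Jσ ⬝ᵥ (H⁻¹ *ᵥ JN) ≠ 0 := by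
    simpa only [hM, det_fin_two_of] using hMinv.ne_zero
  have velocity_iff := mulVec_sub_eq_smul_add_smul_iff hH.det_pos.ne'.isUnit JN JT vminus
  obtain ⟨x₀, y₀, impulse_iff⟩ : ∃ x₀ y₀ : ℝ, ∀ x y : ℝ,
      (x * Jγ ⬝ᵥ (H⁻¹ *ᵥ JN) + y * Jγ ⬝ᵥ (H⁻¹ *ᵥ JT) = -e * (Jγ ⬝ᵥ vminus) - Jγ ⬝ᵥ vminus ∧
        x * Jσ ⬝ᵥ (H⁻¹ *ᵥ JN) + y * Jσ ⬝ᵥ (H⁻¹ *ᵥ JT) = 0 - Jσ ⬝ᵥ vminus) ↔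
      x = x₀ ∧ y = y₀ :=
    ⟨_, _, fun _ _ => linear_system_two_iff hD⟩
  simp only [eq_sub_iff_add_eq'] at impulse_iff
  refine ⟨(x₀, y₀, vminus + (x₀ • (H⁻¹ *ᵥ JN) + y₀ • (H⁻¹ *ᵥ JT))),
    ⟨(velocity_iff _ _ _).2 rfl, ?_⟩, ?_⟩
  · simp only [dotProduct_add, dotProduct_smul, smul_eq_mul]
    exact (impulse_iff _ _).2 ⟨rfl, rfl⟩
  · rintro ⟨x, y, v⟩ ⟨hv, h⟩
    obtain rfl := (velocity_iff v x y).1 hv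
    simp only [dotProduct_add, dotProduct_smul, smul_eq_mul] at h
    obtain ⟨rfl, rfl⟩ := (impulse_iff x y).1 h
    rfl
end
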